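/- Let ψ{♯} be a possibility form and M an epistemic model for atoms P with state s. If M_s ⊨ ψ{◇φ} (where ◇χ := ¬□¬χ), then there is an atom q ∈ P̈∖P not occurring in ψ{♯} or φ such that M̈_s ⊨ ψ{⟨q⟩φ}, where ⟨q⟩χ := ¬[q]¬χ. -/

import Mathlib

/-- Boolean (propositional) formulas over atoms `P`. -/
inductive PLForm (P : Type) : Type
  | atom : P → PLForm P
  | neg : PLForm P → PLForm P
  | and : PLForm P → PLForm P → PLForm P

/-- The language L_BAPAL over agents `A` and atoms `P`. -/
inductive Form (A P : Type) : Type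
  | atom : P → Form A P
  | neg : Form A P → Form A P
  | and : Form A P → Form A P → Form A P
  | know : A → Form A P → Form A P
  | ann : Form A P → Form A P → Form A P
  | box : Form A P → Form A P

def PLForm.toForm {A P : Type} : PLForm P → Form A P
  | .atom p => .atom p
  | .neg φ => .neg φ.toForm
  | .and φ ψ => .and φ.toForm ψ.toForm

structure Model (A P : Type) where
  S : Type
  rel : A → S → S → Prop
  val : P → S → Prop

/-- An epistemic model: each accessibility relation is an equivalence relation. -/
def Model.IsEpistemic {A P : Type} (M : Model A P) : Prop :=
  ∀ a : A, Equivalence (M.rel a)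

/-- Restriction of a model to a subset of its states. -/
def Model.restrict {A P : Type} (M : Model A P) (X : Set M.S) : Model A P where
  S := X
  rel a s t := M.rel a s.val t.val
  val p s := M.val p s.val

/-- Satisfaction of boolean formulas. -/
def SatPL {A P : Type} (M : Model A P) (s : M.S) : PLForm P → Prop
  | .atom p => M.val p s
  | .neg φ => ¬ SatPL M s φ
  | .and φ ψ => SatPL M s φ ∧ SatPL M s ψ

/-- BAPAL satisfaction. -/
def Sat {A P : Type} : (M : Model A P) → M.S → Form A P → Prop
  | M, s, .atom p => M.val p s
  | M, s, .neg φ => ¬ Sat M s φ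
  | M, s, .and φ ψ => Sat M s φ ∧ Sat M s ψ
  | M, s, .know a φ => ∀ t : M.S, M.rel a s t → Sat M t φ
  | M, s, .ann φ ψ => ∀ h : Sat M s φ, Sat (M.restrict {t | Sat M t φ}) ⟨s, h⟩ ψ
  | M, s, .box ψ => ∀ (φ₀ : PLForm P) (h : SatPL M s φ₀),
      Sat (M.restrict {t | SatPL M t φ₀}) ⟨s, h⟩ ψ

def Valid {A P : Type} (φ : Form A P) : Prop :=
  ∀ M : Model A P, M.IsEpistemic → ∀ s : M.S, Sat M s φ

def Form.imp {A P : Type} (φ ψ : Form A P) : Form A P := .neg (.and φ (.neg ψ))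
def Form.iff {A P : Type} (φ ψ : Form A P) : Form A P := .and (φ.imp ψ) (ψ.imp φ)
def Form.dia {A P : Type} (φ : Form A P) : Form A P := .neg (.box (.neg φ))
def Form.khat {A P : Type} (a : A) (φ : Form A P) : Form A P := .neg (.know a (.neg φ))
def Form.diaAnn {A P : Type} (φ ψ : Form A P) : Form A P := .neg (.ann φ (.neg ψ))

def Form.occurs {A P : Type} (q : P) : Form A P → Prop
  | .atom p => p = q
  | .neg φ => φ.occurs q
  | .and φ ψ => φ.occurs q ∨ ψ.occurs q
  | .know _ φ => φ.occurs q
  | .ann φ ψ => φ.occurs q ∨ ψ.occurs q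
  | .box φ => φ.occurs q

def Form.mapAtoms {A P Q : Type} (f : P → Q) : Form A P → Form A Q
  | .atom p => .atom (f p)
  | .neg φ => .neg (φ.mapAtoms f)
  | .and φ ψ => .and (φ.mapAtoms f) (ψ.mapAtoms f)
  | .know a φ => .know a (φ.mapAtoms f)
  | .ann φ ψ => .ann (φ.mapAtoms f) (ψ.mapAtoms f)
  | .box φ => .box (φ.mapAtoms f)

/-- The extended atom set `P̈ = P ∪ {p_{φ₀} : φ₀ ∈ L_PL(P)}`: the right summand
provides a fresh atom `p_{φ₀}` for every boolean `φ₀` over `P`. -/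
abbrev DDotAtoms (P : Type) : Type := P ⊕ PLForm P

/-- The boolean closure `M̈` of a model `M` for atoms `P`: same states and relations,
and the fresh atom `p_{φ₀}` is assigned the value `⟦φ₀⟧_M`. -/
def Model.ddot {A P : Type} (M : Model A P) : Model A (DDotAtoms P) where
  S := M.S
  rel := M.rel
  val q s := match q with
    | .inl p => M.val p s
    | .inr φ₀ => SatPL M s φ₀

/-- Possibility forms: `♯ | φ ∧ ψ{♯} | K̂_a ψ{♯} | ⟨φ⟩ψ{♯}`. -/
inductive PossForm (A P : Type) : Type
  | hole : PossForm A P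
  | and : Form A P → PossForm A P → PossForm A P
  | khat : A → PossForm A P → PossForm A P
  | dia : Form A P → PossForm A P → PossForm A P

/-- Substitution of a formula for the placeholder `♯` in a possibility form. -/
def PossForm.subst {A P : Type} : PossForm A P → Form A P → Form A P
  | .hole, χ => χ
  | .and φ pf, χ => .and φ (pf.subst χ)
  | .khat a pf, χ => Form.khat a (pf.subst χ)
  | .dia φ pf, χ => Form.diaAnn φ (pf.subst χ)

/-- Renaming the atoms of a possibility form. -/
def PossForm.mapAtoms {A P Q : Type} (f : P → Q) : PossForm A P → PossForm A Q
  | .hole => .hole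
  | .and φ pf => .and (φ.mapAtoms f) (pf.mapAtoms f)
  | .khat a pf => .khat a (pf.mapAtoms f)
  | .dia φ pf => .dia (φ.mapAtoms f) (pf.mapAtoms f)

/-- An atom occurring in a possibility form. -/
def PossForm.occurs {A P : Type} (q : P) : PossForm A P → Prop
  | .hole => False
  | .and φ pf => φ.occurs q ∨ pf.occurs q
  | .khat _ pf => pf.occurs q
  | .dia φ pf => φ.occurs q ∨ pf.occurs q

theorem satPL_restrict {A P : Type} (M : Model A P) (X : Set M.S) (s : X) (φ : PLForm P) :
    SatPL (M.restrict X) s φ ↔ SatPL M s.val φ := by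
  induction φ with
  | atom p => exact Iff.rfl
  | neg φ ih => exact not_congr ih
  | and φ ψ ih₁ ih₂ => exact and_congr ih₁ ih₂

theorem sat_congr_val {A P S : Type} {rel : A → S → S → Prop} {v w : P → S → Prop}
    (h : ∀ p s, v p s ↔ w p s) (s : S) (φ : Form A P) :
    Sat ⟨S, rel, v⟩ s φ ↔ Sat ⟨S, rel, w⟩ s φ := by
  obtain rfl : v = w := funext fun p => funext fun s => propext (h p s)
  exact Iff.rfl

theorem sat_restrict_congr {A P : Type} {M : Model A P} {X Y : Set M.S}
    (hXY : ∀ t, t ∈ X ↔ t ∈ Y) {s : M.S} (hX : s ∈ X) (hY : s ∈ Y) (φ : Form A P) :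
    Sat (M.restrict X) ⟨s, hX⟩ φ ↔ Sat (M.restrict Y) ⟨s, hY⟩ φ := by
  obtain rfl : X = Y := Set.ext hXY
  exact Iff.rfl

/-- Boolean closure commutes with restriction, at the level of satisfaction. -/
theorem sat_ddot_restrict {A P : Type} (M : Model A P) (X : Set M.S) (s : X)
    (φ : Form A (DDotAtoms P)) :
    Sat (M.ddot.restrict X) s φ ↔ Sat (M.restrict X).ddot s φ := by
  refine sat_congr_val (fun q t => ?_) s φ
  cases q with
  | inl p => exact Iff.rfl
  | inr φ₀ => exact (satPL_restrict M X t φ₀).symm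

/-- Replace each atom `p_{φ₀}` by the boolean formula `φ₀` it names. -/
def PLForm.flatten {P : Type} : PLForm (DDotAtoms P) → PLForm P
  | .atom (.inl p) => .atom p
  | .atom (.inr φ₀) => φ₀
  | .neg φ => .neg φ.flatten
  | .and φ ψ => .and φ.flatten ψ.flatten

theorem satPL_flatten {A P : Type} (M : Model A P) (s : M.S) (φ : PLForm (DDotAtoms P)) :
    SatPL M s φ.flatten ↔ SatPL M.ddot s φ := by
  induction φ with
  | atom q => cases q <;> exact Iff.rfl
  | neg φ ih => exact not_congr ih
  | and φ ψ ih₁ ih₂ => exact and_congr ih₁ ih₂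

theorem sat_ddot_mapAtoms {A P : Type} (φ : Form A P) (M : Model A P) (s : M.S) :
    Sat M.ddot s (φ.mapAtoms Sum.inl) ↔ Sat M s φ := by
  induction φ generalizing M with
  | atom p => exact Iff.rfl
  | neg φ ih => exact not_congr (ih M s)
  | and φ ψ ih₁ ih₂ => exact and_congr (ih₁ M s) (ih₂ M s)
  | know a φ ih => exact forall_congr' fun t => imp_congr_right fun _ => ih M t
  | ann φ ψ ih₁ ih₂ =>
    have key (h : Sat M.ddot s (φ.mapAtoms Sum.inl)) (h' : Sat M s φ) :=
      (sat_restrict_congr (M := M.ddot) (X := {t | Sat M.ddot t (φ.mapAtoms Sum.inl)})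
        (Y := {t | Sat M t φ}) (ih₁ M) h h' _).trans
        ((sat_ddot_restrict M _ _ _).trans (ih₂ _ _))
    exact ⟨fun H h => (key ((ih₁ M s).2 h) h).1 (H _),
      fun H h => (key h ((ih₁ M s).1 h)).2 (H _)⟩
  | box φ ih =>
    have key (φ₀ : PLForm (DDotAtoms P)) (φ₁ : PLForm P)
        (e : ∀ t, SatPL M.ddot t φ₀ ↔ SatPL M t φ₁) :
        (∀ h : SatPL M.ddot s φ₀,
          Sat (M.ddot.restrict {t | SatPL M.ddot t φ₀}) ⟨s, h⟩ (φ.mapAtoms Sum.inl)) ↔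
        ∀ h : SatPL M s φ₁, Sat (M.restrict {t | SatPL M t φ₁}) ⟨s, h⟩ φ := by
      have aux (h : SatPL M.ddot s φ₀) (h' : SatPL M s φ₁) :=
        (sat_restrict_congr (M := M.ddot) (X := {t | SatPL M.ddot t φ₀})
          (Y := {t | SatPL M t φ₁}) e h h' (φ.mapAtoms Sum.inl)).trans
          ((sat_ddot_restrict M _ _ _).trans (ih _ _))
      exact ⟨fun H h => (aux ((e s).2 h) h).1 (H _), fun H h => (aux h ((e s).1 h)).2 (H _)⟩
    constructor
    · intro H φ₀
      exact (key (.atom (.inr φ₀)) φ₀ fun _ => Iff.rfl).1 (H _)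
    · intro H φ₀
      exact (key φ₀ φ₀.flatten fun t => (satPL_flatten M t φ₀).symm).2 (H _)

theorem sat_diaAnn {A P : Type} {M : Model A P} {s : M.S} {φ ψ : Form A P} :
    Sat M s (φ.diaAnn ψ) ↔
      ∃ h : Sat M s φ, Sat (M.restrict {t | Sat M t φ}) ⟨s, h⟩ ψ := by
  simp only [Form.diaAnn, Sat, not_forall, not_not]

theorem sat_khat {A P : Type} {M : Model A P} {s : M.S} {a : A} {φ : Form A P} :
    Sat M s (Form.khat a φ) ↔ ∃ t, M.rel a s t ∧ Sat M t φ := by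
  simp only [Form.khat, Sat, not_forall, not_not, exists_prop]

theorem sat_dia {A P : Type} {M : Model A P} {s : M.S} {φ : Form A P} :
    Sat M s φ.dia ↔ ∃ (φ₀ : PLForm P) (h : SatPL M s φ₀),
      Sat (M.restrict {t | SatPL M t φ₀}) ⟨s, h⟩ φ := by
  simp only [Form.dia, Sat, not_forall, not_not]

theorem Form.not_occurs_inr_mapAtoms {A P Q : Type} (φ : Form A P) (q : Q) :
    ¬ (φ.mapAtoms (Sum.inl : P → P ⊕ Q)).occurs (Sum.inr q) := by
  induction φ <;> simp_all [Form.mapAtoms, Form.occurs]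

theorem PossForm.not_occurs_inr_mapAtoms {A P Q : Type} (pf : PossForm A P) (q : Q) :
    ¬ (pf.mapAtoms (Sum.inl : P → P ⊕ Q)).occurs (Sum.inr q) := by
  induction pf <;>
    simp_all [PossForm.mapAtoms, PossForm.occurs, Form.not_occurs_inr_mapAtoms]

theorem exists_sat_ddot_subst_diaAnn {A P : Type} (pf : PossForm A P) (φ : Form A P)
    (M : Model A P) (s : M.S) (h : Sat M s (pf.subst φ.dia)) :
    ∃ φ₀ : PLForm P, Sat M.ddot s ((pf.mapAtoms Sum.inl).subst
      (Form.diaAnn (.atom (Sum.inr φ₀)) (φ.mapAtoms Sum.inl))) := by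
  induction pf generalizing M with
  | hole =>
    obtain ⟨φ₀, h₀, hφ⟩ := sat_dia.1 h
    exact ⟨φ₀, sat_diaAnn.2 ⟨h₀, (sat_ddot_restrict M _ _ _).2
      ((sat_ddot_mapAtoms φ _ _).2 hφ)⟩⟩
  | and χ pf ih =>
    obtain ⟨φ₀, h₀⟩ := ih M s h.2
    exact ⟨φ₀, (sat_ddot_mapAtoms χ M s).2 h.1, h₀⟩
  | khat a pf ih =>
    obtain ⟨t, hst, ht⟩ := sat_khat.1 h
    obtain ⟨φ₀, h₀⟩ := ih M t ht
    exact ⟨φ₀, sat_khat.2 ⟨t, hst, h₀⟩⟩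
  | dia χ pf ih =>
    obtain ⟨hχ, hs⟩ := sat_diaAnn.1 h
    obtain ⟨φ₀, h₀⟩ := ih _ _ hs
    have hχ' := (sat_ddot_mapAtoms χ M s).2 hχ
    exact ⟨φ₀, sat_diaAnn.2 ⟨hχ', (sat_restrict_congr (M := M.ddot)
      (sat_ddot_mapAtoms χ M) hχ' hχ _).2 ((sat_ddot_restrict M _ _ _).2 h₀)⟩⟩

/-- if `M_s ⊨ ψ{◇φ}` then there is a fresh atom `q ∈ P̈∖P`, occurring
neither in `ψ{♯}` nor in `φ`, such that `M̈_s ⊨ ψ{⟨q⟩φ}`. -/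
theorem possForm_fresh_witness {A : Type} [Countable A]
    (pf : PossForm A ℕ) (φ : Form A ℕ)
    (M : Model A ℕ) (hM : M.IsEpistemic) (s : M.S)
    (h : Sat M s (pf.subst (Form.dia φ))) :
    ∃ φ₀ : PLForm ℕ,
      ¬ (pf.mapAtoms (Sum.inl : ℕ → DDotAtoms ℕ)).occurs (Sum.inr φ₀) ∧
      ¬ (φ.mapAtoms (Sum.inl : ℕ → DDotAtoms ℕ)).occurs (Sum.inr φ₀) ∧
      Sat M.ddot s
        ((pf.mapAtoms Sum.inl).subst
          (Form.diaAnn (.atom (Sum.inr φ₀)) (φ.mapAtoms Sum.inl))) := by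
  obtain ⟨φ₀, h₀⟩ := exists_sat_ddot_subst_diaAnn pf φ M s h
  exact ⟨φ₀, pf.not_occurs_inr_mapAtoms φ₀, φ.not_occurs_inr_mapAtoms φ₀, h₀⟩
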